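/- arXiv:math/0602355 — 4 statements merged into one kernel-verified Lean document; each statement's English description precedes it below -/
import Mathlib

section
/- Let k be a field of characteristic different from 2, let a, b, c be nonzero elements of k, and let L/k be a finite field extension of odd degree. If there exists (x, y, z) ∈ L³ with (x, y, z) ≠ (0, 0, 0) and a·x² + b·y² = c·z², then there exists (x₀, y₀, z₀) ∈ k³ with (x₀, y₀, z₀) ≠ (0, 0, 0) and a·x₀² + b·y₀² = c·z₀². -/
/-- The determinant of `U² - d V²` for commuting `U, V` is of the form `p² - d q²`. -/
theorem det_sq_sub_aux {k n : Type} [Field k] [Fintype n] [DecidableEq n] (d : k)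
    (U V : Matrix n n k) (h : U * V = V * U) :
    ∃ p q : k, (U * U - d • (V * V)).det = p ^ 2 - d * q ^ 2 := by
  let R := QuadraticAlgebra k d 0
  let w : R := ⟨0, 1⟩
  have hw : w * w = algebraMap k R d := by
    ext <;> simp [w, R]
  have hs : star w = -w := by
    ext <;> simp [w, R]
  let f : Matrix n n k →+* Matrix n n R := (algebraMap k R).mapMatrix
  have hfs : ∀ M : Matrix n n k, (f M).map (starRingEnd R) = f M := by
    intro M
    ext i j <;> simp [f, R, starRingEnd_apply]
  let D : R := (f U + w • f V).det
  have hD : star D = (f U - w • f V).det := by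
    have := (starRingEnd R).map_det (f U + w • f V)
    rw [starRingEnd_apply] at this
    rw [this]
    congr 1
    ext1 i j
    have h1 := congrFun (congrFun (hfs U) i) j
    have h2 := congrFun (congrFun (hfs V) i) j
    simp only [Matrix.map_apply] at h1 h2
    simp only [RingHom.mapMatrix_apply, Matrix.map_apply, Matrix.add_apply, Matrix.sub_apply,
      Matrix.smul_apply, smul_eq_mul, map_add, map_mul, h1, h2]
    rw [starRingEnd_apply, hs]
    ring
  have hcomm : f U * f V = f V * f U := by rw [← map_mul, h, map_mul]
  have hprod : D * star D = algebraMap k R (U * U - d • (V * V)).det := by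
    rw [hD, ← Matrix.det_mul, RingHom.map_det]
    congr 1
    have e : f (U * U - d • (V * V)) = f U * f U - (w * w) • (f V * f V) := by
      rw [map_sub, map_mul, hw, ← map_mul f V V]
      congr 1
      ext1 i j
      simp [f, ← Matrix.map_mul]
    change _ = f _
    rw [e, add_mul, mul_sub, mul_sub, Matrix.smul_mul, Matrix.smul_mul, Matrix.mul_smul,
      Matrix.mul_smul, hcomm, smul_smul]
    abel
  refine ⟨D.re, D.im, ?_⟩
  have := congrArg QuadraticAlgebra.re hprod
  simp [R] at this
  rw [← this]
  ring

/-- The norm of `u² - d v²` is of the form `p² - d q²`. -/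
theorem norm_sq_sub_aux {k L : Type} [Field k] [Field L] [Algebra k L] [FiniteDimensional k L]
    (d : k) (u v : L) :
    ∃ p q : k, Algebra.norm k (u ^ 2 - algebraMap k L d * v ^ 2) = p ^ 2 - d * q ^ 2 := by
  let B := Module.finBasis k L
  obtain ⟨p, q, h⟩ := det_sq_sub_aux d (Algebra.leftMulMatrix B u) (Algebra.leftMulMatrix B v)
    (by rw [← map_mul, mul_comm, map_mul])
  refine ⟨p, q, ?_⟩
  rw [← h, Algebra.norm_eq_matrix_det B, ← map_mul, ← map_mul, ← map_smul, ← map_sub,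
    Algebra.smul_def, sq, sq]

/-- Springer's theorem for conics: Let `k` be a field of characteristic `≠ 2`,
`a b c` nonzero elements of `k`, and `L/k` a finite extension of odd degree. If the conic
`a·x² + b·y² = c·z²` has a nontrivial solution over `L`, then it has one over `k`. -/
theorem conic_has_nontrivial_solution_of_odd_degree_extension
    (k L : Type) [Field k] [Field L] [Algebra k L] [FiniteDimensional k L]
    (hchar : ringChar k ≠ 2) (hodd : Odd (Module.finrank k L))
    (a b c : k) (ha : a ≠ 0) (hb : b ≠ 0) (hc : c ≠ 0)
    (hL : ∃ x y z : L, (x, y, z) ≠ (0, 0, 0) ∧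
      algebraMap k L a * x ^ 2 + algebraMap k L b * y ^ 2 = algebraMap k L c * z ^ 2) :
    ∃ x₀ y₀ z₀ : k, (x₀, y₀, z₀) ≠ (0, 0, 0) ∧ a * x₀ ^ 2 + b * y₀ ^ 2 = c * z₀ ^ 2 := by
  obtain ⟨x, y, z, hne, h⟩ := hL
  obtain ⟨m, hm⟩ := hodd
  have ha' : algebraMap k L a ≠ 0 := by simpa using ha
  by_cases hz : z = 0
  · subst hz
    have hy : y ≠ 0 := by
      rintro rfl
      apply hne
      simp [ha] at h
      simp [h]
    have hd : algebraMap k L (-(a * b)) = (algebraMap k L a * x / y) ^ 2 := by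
      rw [map_neg, map_mul]
      field_simp
      linear_combination (-1 : L) * h
    have hN := congrArg (Algebra.norm k) hd
    rw [Algebra.norm_algebraMap, map_pow, hm] at hN
    set s := Algebra.norm k (algebraMap k L a * x / y)
    have hab : (-(a * b)) ^ m ≠ 0 := pow_ne_zero _ (by simp [ha, hb])
    refine ⟨s, a * (-(a * b)) ^ m, 0, by simp [ha, hb], ?_⟩
    rw [← hN]
    ring
  · have hd : algebraMap k L (a * c) = (algebraMap k L a * x / z) ^ 2
        - algebraMap k L (-(a * b)) * (y / z) ^ 2 := by
      rw [map_neg, map_mul, map_mul]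
      field_simp
      linear_combination (-1 : L) * h
    obtain ⟨p, q, hpq⟩ := norm_sq_sub_aux (-(a * b)) (algebraMap k L a * x / z) (y / z)
    rw [← hd, Algebra.norm_algebraMap, hm] at hpq
    refine ⟨p, a * q, a * (a * c) ^ m, by simp [ha, hc], ?_⟩
    linear_combination (-a) * hpq
end

section
/- The only integer solution of the equation 3x³ + 4y³ + 5z³ = 0 is x = y = z = 0. Equivalently, the Selmer curve 3X³ + 4Y³ + 5Z³ = 0 has no rational point in the projective plane. -/
open Polynomial NumberField

namespace Selmer

noncomputable def fZ : ℤ[X] := X ^ 3 - C 6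

lemma fZ_monic : fZ.Monic := by
  unfold fZ; monicity!

lemma fZ_natDegree : fZ.natDegree = 3 := by
  unfold fZ; compute_degree!

lemma fZ_eisenstein (p : ℤ) (hp : Prime p) (h1 : p ∣ 6) (h2 : ¬ p ^ 2 ∣ 6) :
    fZ.IsEisensteinAt (Submodule.span ℤ {p}) := by
  refine ⟨?_, ?_, ?_⟩
  · rw [fZ_monic.leadingCoeff]
    intro h
    exact hp.not_dvd_one (Ideal.mem_span_singleton.1 h)
  · intro n hn
    rw [fZ_natDegree] at hn
    refine Ideal.mem_span_singleton.2 ?_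
    interval_cases n
    · simpa [fZ, coeff_X_pow] using h1
    · simp [fZ, coeff_X_pow]
    · simp [fZ, coeff_X_pow]
  · intro h
    have h' : fZ.coeff 0 ∈ (Ideal.span {p}) ^ 2 := h
    rw [Ideal.span_singleton_pow, Ideal.mem_span_singleton] at h'
    apply h2
    simpa [fZ, coeff_X_pow] using h'

lemma fZ_irreducible : Irreducible fZ :=
  (fZ_eisenstein 2 Int.prime_two (by norm_num) (by norm_num)).irreducible
    ((Ideal.span_singleton_prime (by norm_num)).2 Int.prime_two) fZ_monic.isPrimitive
    (by rw [fZ_natDegree]; norm_num)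

noncomputable def f : ℚ[X] := X ^ 3 - C 6

lemma f_eq : f = fZ.map (algebraMap ℤ ℚ) := by
  simp only [f, fZ, Polynomial.map_sub, Polynomial.map_pow, map_X, map_C]
  simp

lemma f_irreducible : Irreducible f := by
  rw [f_eq]
  exact (fZ_monic.irreducible_iff_irreducible_map_fraction_map).1 fZ_irreducible

lemma f_monic : f.Monic := by
  unfold f; monicity!

lemma f_natDegree : f.natDegree = 3 := by
  unfold f; compute_degree!

instance : Fact (Irreducible f) := ⟨f_irreducible⟩

lemma integral_mem {K : Type} [Field K] [NumberField K] (B : PowerBasis ℚ K)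
    (hB : minpoly ℚ B.gen = f) (z : K) (hz : IsIntegral ℤ z) :
    z ∈ Algebra.adjoin ℤ ({B.gen} : Set K) := by
  have hroot : B.gen ^ 3 = 6 := by
    have := minpoly.aeval ℚ B.gen
    rw [hB] at this
    simp [f] at this
    linear_combination this
  have hint : IsIntegral ℤ B.gen := ⟨fZ, fZ_monic, by simp [fZ, hroot]⟩
  have hmin : minpoly ℤ B.gen = fZ := by
    have h₁ := minpoly.isIntegrallyClosed_eq_field_fractions' ℚ hint
    rw [hB, f_eq] at h₁
    exact (map_injective (algebraMap ℤ ℚ) (algebraMap ℤ ℚ).injective_int h₁).symm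
  have hdim : B.dim = 3 := by rw [← B.natDegree_minpoly, hB, f_natDegree]
  have hfr : Module.finrank ℚ K = 3 := by rw [B.finrank, hdim]
  have hdisc : Algebra.discr ℚ B.basis = -972 := by
    rw [Algebra.discr_powerBasis_eq_norm, hB, hfr]
    have : aeval B.gen (derivative f) = algebraMap ℚ K 3 * B.gen ^ 2 := by
      simp [f]
      norm_num
    rw [this, map_mul, map_pow, Algebra.norm_algebraMap, hfr,
      Algebra.PowerBasis.norm_gen_eq_coeff_zero_minpoly, hB, hdim]
    simp [f, coeff_X_pow]
    norm_num
  have H := Algebra.discr_mul_isIntegral_mem_adjoin ℚ hint hz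
  rw [hdisc] at H
  have e3 : (minpoly ℤ B.gen).IsEisensteinAt (Submodule.span ℤ {(3:ℤ)}) := by
    rw [hmin]; exact fZ_eisenstein 3 Int.prime_three (by norm_num) (by norm_num)
  have e2 : (minpoly ℤ B.gen).IsEisensteinAt (Submodule.span ℤ {(2:ℤ)}) := by
    rw [hmin]; exact fZ_eisenstein 2 Int.prime_two (by norm_num) (by norm_num)
  refine mem_adjoin_of_smul_prime_pow_smul_of_minpoly_isEisensteinAt (n := 5)
    Int.prime_three hint hz ?_ e3
  refine mem_adjoin_of_smul_prime_pow_smul_of_minpoly_isEisensteinAt (n := 2)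
    Int.prime_two hint (hz.smul _) ?_ e2
  have := neg_mem H
  convert this using 1
  rw [smul_smul, zsmul_eq_mul, Algebra.smul_def]
  norm_num

lemma exists_basis {K : Type} [Field K] [NumberField K] (B : PowerBasis ℚ K)
    (hB : minpoly ℚ B.gen = f) : ∃ (θ : 𝓞 K) (b : Module.Basis (Fin 3) ℤ (𝓞 K)),
      θ ^ 3 = 6 ∧ b 0 = 1 ∧ b 1 = θ ∧ b 2 = θ ^ 2 := by
  have hroot : B.gen ^ 3 = 6 := by
    have := minpoly.aeval ℚ B.gen
    rw [hB] at this
    simp [f] at this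
    linear_combination this
  have hint : IsIntegral ℤ B.gen := ⟨fZ, fZ_monic, by simp [fZ, hroot]⟩
  let θ : 𝓞 K := ⟨B.gen, hint⟩
  have hθ : algebraMap (𝓞 K) K θ = B.gen := rfl
  have hθ3 : θ ^ 3 = 6 := by
    apply RingOfIntegers.coe_injective
    rw [map_pow, hθ, hroot]; exact (map_ofNat _ 6).symm
  have hli : LinearIndependent ℤ ![1, θ, θ ^ 2] := by
    rw [Fintype.linearIndependent_iff]
    intro g hg
    simp [Fin.sum_univ_three] at hg
    let q : ℚ[X] := C (g 2 : ℚ) * X ^ 2 + C (g 1 : ℚ) * X + C (g 0 : ℚ)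
    have hq : q = 0 := by
      by_contra hne
      have h0 : aeval B.gen q = 0 := by
        have := congrArg (algebraMap (𝓞 K) K) hg
        simp [hθ] at this
        simp [q]
        linear_combination this
      have h1 := natDegree_le_of_dvd (minpoly.dvd ℚ B.gen h0) hne
      have h2 : q.natDegree ≤ 2 := natDegree_quadratic_le
      rw [hB, f_natDegree] at h1
      omega
    have c0 := congrArg (fun p => p.coeff 0) hq
    have c1 := congrArg (fun p => p.coeff 1) hq
    have c2 := congrArg (fun p => p.coeff 2) hq
    simp [q, coeff_X, coeff_C, -map_intCast, -eq_intCast] at c0 c1 c2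
    intro i
    fin_cases i <;> simpa
  have hsp : ⊤ ≤ Submodule.span ℤ (Set.range ![1, θ, θ ^ 2]) := by
    rintro z -
    have key : ∀ w ∈ Algebra.adjoin ℤ ({B.gen} : Set K),
        ∃ p q r : ℤ, w = p + q * B.gen + r * B.gen ^ 2 := by
      intro w hw
      induction hw using Algebra.adjoin_induction with
      | mem x hx => exact ⟨0, 1, 0, by simp at hx; simp [hx]⟩
      | algebraMap n => exact ⟨n, 0, 0, by simp⟩
      | add x y _ _ hx hy =>
        obtain ⟨p, q, r, rfl⟩ := hx
        obtain ⟨p', q', r', rfl⟩ := hy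
        exact ⟨p + p', q + q', r + r', by push_cast; ring⟩
      | mul x y _ _ hx hy =>
        obtain ⟨p, q, r, rfl⟩ := hx
        obtain ⟨p', q', r', rfl⟩ := hy
        refine ⟨p * p' + 6 * (q * r' + r * q'), p * q' + q * p' + 6 * (r * r'),
          p * r' + q * q' + r * p', ?_⟩
        push_cast
        linear_combination (q * r' + r * q' + r * r' * B.gen : K) * hroot
    obtain ⟨p, q, r, h⟩ := key _ (integral_mem B hB z z.2)
    have : z = p • 1 + q • θ + r • θ ^ 2 := by
      apply RingOfIntegers.coe_injective
      simp [hθ]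
      exact h
    rw [this]
    refine add_mem (add_mem ?_ ?_) ?_ <;> refine Submodule.smul_mem _ _ (Submodule.subset_span ?_)
    · exact ⟨0, rfl⟩
    · exact ⟨1, rfl⟩
    · exact ⟨2, rfl⟩
  exact ⟨θ, Module.Basis.mk hli hsp, hθ3, by simp, by simp, by simp⟩

lemma exists_field : ∃ (K : Type) (_ : Field K) (_ : NumberField K) (θ : 𝓞 K)
    (b : Module.Basis (Fin 3) ℤ (𝓞 K)), θ ^ 3 = 6 ∧ b 0 = 1 ∧ b 1 = θ ∧ b 2 = θ ^ 2 := by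
  let B := AdjoinRoot.powerBasis f_irreducible.ne_zero
  have hB : minpoly ℚ B.gen = f := by
    have := AdjoinRoot.minpoly_powerBasis_gen_of_monic f_monic
    exact this
  have : FiniteDimensional ℚ (AdjoinRoot f) := B.finite
  have : NumberField (AdjoinRoot f) :=
    { to_charZero := algebraRat.charZero _, to_finiteDimensional := this }
  exact ⟨AdjoinRoot f, inferInstance, this, exists_basis B hB⟩

section
variable {K : Type} [Field K] [NumberField K] {θ : 𝓞 K} {b : Module.Basis (Fin 3) ℤ (𝓞 K)}

/-- `1, θ, θ²` is an integral basis of `K`, and `θ³ = 6`. -/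
def Good (θ : 𝓞 K) (b : Module.Basis (Fin 3) ℤ (𝓞 K)) : Prop :=
  θ ^ 3 = 6 ∧ b 0 = 1 ∧ b 1 = θ ∧ b 2 = θ ^ 2

lemma Good.rep (h : Good θ b) (x : 𝓞 K) : ∃ p q r : ℤ, x = p + q * θ + r * θ ^ 2 := by
  obtain ⟨h3, h0, h1, h2⟩ := h
  refine ⟨b.repr x 0, b.repr x 1, b.repr x 2, ?_⟩
  conv_lhs => rw [← b.sum_repr x]
  simp [Fin.sum_univ_three, h0, h1, h2]

lemma Good.repr_eq (h : Good θ b) (p q r : ℤ) :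
    (b.repr (p + q * θ + r * θ ^ 2) : Fin 3 → ℤ) = ![p, q, r] := by
  obtain ⟨h3, h0, h1, h2⟩ := h
  have : (p + q * θ + r * θ ^ 2 : 𝓞 K) = p • b 0 + q • b 1 + r • b 2 := by
    simp [h0, h1, h2]
  rw [this]
  simp only [map_add, map_smul, b.repr_self]
  ext i
  fin_cases i <;> simp

lemma Good.inj (h : Good θ b) {p q r p' q' r' : ℤ}
    (e : (p + q * θ + r * θ ^ 2 : 𝓞 K) = p' + q' * θ + r' * θ ^ 2) :
    p = p' ∧ q = q' ∧ r = r' := by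
  have h1 := h.repr_eq p q r
  rw [e, h.repr_eq] at h1
  have a0 := congrFun h1 0
  have a1 := congrFun h1 1
  have a2 := congrFun h1 2
  simp at a0 a1 a2
  exact ⟨a0.symm, a1.symm, a2.symm⟩

lemma Good.mat (h : Good θ b) (p q r : ℤ) :
    Algebra.leftMulMatrix b (p + q * θ + r * θ ^ 2) =
      !![p, 6 * r, 6 * q; q, p, 6 * r; r, q, p] := by
  have h3 := h.1
  have e0 : (p + q * θ + r * θ ^ 2) * b 0 = p + q * θ + r * θ ^ 2 := by simp [h.2.1]
  have e1 : (p + q * θ + r * θ ^ 2) * b 1 = (6 * r : ℤ) + p * θ + q * θ ^ 2 := by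
    rw [h.2.2.1]; push_cast; linear_combination (r : 𝓞 K) * h3
  have e2 : (p + q * θ + r * θ ^ 2) * b 2 = (6 * q : ℤ) + (6 * r : ℤ) * θ + p * θ ^ 2 := by
    rw [h.2.2.2]; push_cast; linear_combination (q + r * θ : 𝓞 K) * h3
  ext i j
  rw [Algebra.leftMulMatrix_eq_repr_mul]
  fin_cases j
  · simp only [Fin.zero_eta]
    rw [e0, h.repr_eq]; fin_cases i <;> simp
  · simp only [Fin.mk_one]
    rw [e1, h.repr_eq]; fin_cases i <;> simp
  · simp only [Fin.reduceFinMk]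
    rw [e2, h.repr_eq]; fin_cases i <;> simp

lemma Good.norm (h : Good θ b) (p q r : ℤ) :
    Algebra.norm ℤ (p + q * θ + r * θ ^ 2 : 𝓞 K) =
      p ^ 3 + 6 * q ^ 3 + 36 * r ^ 3 - 18 * p * q * r := by
  rw [Algebra.norm_eq_matrix_det b, h.mat, Matrix.det_fin_three]
  simp
  ring

lemma Good.trace (h : Good θ b) (p q r : ℤ) :
    Algebra.trace ℤ (𝓞 K) (p + q * θ + r * θ ^ 2 : 𝓞 K) = 3 * p := by
  rw [Algebra.trace_eq_matrix_trace b, h.mat, Matrix.trace_fin_three]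
  simp
  ring

lemma Good.discr (h : Good θ b) : discr K = -972 := by
  have h3 := h.1
  have t (i j : Fin 3) (p q r : ℤ) (e : b i * b j = p + q * θ + r * θ ^ 2) :
      Algebra.traceMatrix ℤ b i j = 3 * p := by
    rw [Algebra.traceMatrix_apply, Algebra.traceForm_apply, e, h.trace]
  rw [← NumberField.discr_eq_discr K b, Algebra.discr_def, Matrix.det_fin_three,
    t 0 0 1 0 0 (by simp [h.2]), t 0 1 0 1 0 (by simp [h.2]), t 0 2 0 0 1 (by simp [h.2]),
    t 1 0 0 1 0 (by simp [h.2]), t 1 1 0 0 1 (by simp [h.2]; ring),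
    t 1 2 6 0 0 (by simp [h.2]; linear_combination h3),
    t 2 0 0 0 1 (by simp [h.2]),
    t 2 1 6 0 0 (by simp [h.2]; linear_combination h3),
    t 2 2 0 6 0 (by simp [h.2]; linear_combination θ * h3)]
  norm_num

lemma Good.finrank (_ : Good θ b) : Module.finrank ℚ K = 3 := by
  rw [← RingOfIntegers.rank, Module.finrank_eq_card_basis b]; simp

lemma Good.places (h : Good θ b) :
    InfinitePlace.nrRealPlaces K = 1 ∧ InfinitePlace.nrComplexPlaces K = 1 := by
  have h1 := InfinitePlace.card_add_two_mul_card_eq_rank K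
  rw [h.finrank] at h1
  have h2 := NumberField.sign_discr K
  rw [h.discr] at h2
  have : InfinitePlace.nrComplexPlaces K ≠ 0 := by
    intro h0; rw [h0] at h2; revert h2; decide
  omega

lemma principal_of_norm {P : Ideal (𝓞 K)} (hP : P.IsPrime) {x : 𝓞 K} (hx : x ∈ P)
    (hn : (Algebra.norm ℤ x).natAbs.Prime) : Submodule.IsPrincipal P := by
  have h1 : Ideal.absNorm (Ideal.span {x}) = (Algebra.norm ℤ x).natAbs :=
    Ideal.absNorm_span_singleton x
  have h2 : (Ideal.span {x}).IsPrime :=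
    Ideal.isPrime_of_irreducible_absNorm (by rw [h1]; exact hn)
  have h0 : Ideal.span {x} ≠ ⊥ := by
    intro h
    rw [h, Ideal.absNorm_bot] at h1
    exact hn.ne_zero h1.symm
  have h3 := h2.isMaximal h0
  have h4 := h3.eq_of_le hP.ne_top ((Ideal.span_singleton_le_iff_mem P).2 hx)
  exact ⟨x, h4.symm⟩

lemma Good.minkowski (h : Good θ b) : (4 / Real.pi) ^ InfinitePlace.nrComplexPlaces K *
    ((Module.finrank ℚ K).factorial / (Module.finrank ℚ K : ℝ) ^ Module.finrank ℚ K *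
      √|(NumberField.discr K : ℝ)|) < 9 := by
  rw [h.places.2, h.finrank, h.discr]
  have h1 : √|((-972 : ℤ) : ℝ)| < 31.2 := by
    rw [Real.sqrt_lt' (by norm_num)]
    norm_num
  have h2 : 4 / Real.pi < 4 / 3.14 := by
    have := Real.pi_gt_d2
    gcongr
  have h3 : ((Nat.factorial 3 : ℕ) : ℝ) = 6 := by norm_num [Nat.factorial]
  rw [h3, pow_one]
  calc _ < 4 / 3.14 * (6 / ((3 : ℕ) : ℝ) ^ 3 * 31.2) := by
        gcongr
    _ < 9 := by norm_num

lemma Good.principal (h : Good θ b) {P : Ideal (𝓞 K)} (hP : P.IsPrime)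
    (h0 : P ≠ ⊥) (h9 : Ideal.absNorm P < 9) : Submodule.IsPrincipal P := by
  have h3 := h.1
  have hone : (1 : 𝓞 K) ∉ P := fun h1 => hP.ne_top ((Ideal.eq_top_iff_one P).2 h1)
  have hmem := Ideal.absNorm_mem P
  have hn0 : Ideal.absNorm P ≠ 0 := by
    rwa [Ne, Ideal.absNorm_eq_zero_iff]
  have go (p q r : ℤ) (hm : (p + q * θ + r * θ ^ 2 : 𝓞 K) ∈ P)
      (hpr : (p ^ 3 + 6 * q ^ 3 + 36 * r ^ 3 - 18 * p * q * r).natAbs.Prime) :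
      Submodule.IsPrincipal P := by
    apply principal_of_norm hP hm
    rwa [h.norm]
  have c2 (h2 : (2 : 𝓞 K) ∈ P) : Submodule.IsPrincipal P := by
    have ht : θ ∈ P := hP.mem_of_pow_mem 3 (by
      rw [h3, show (6 : 𝓞 K) = 3 * 2 by norm_num]; exact P.mul_mem_left _ h2)
    refine go 2 (-1) 0 ?_ (by norm_num)
    have := P.sub_mem h2 ht
    convert this using 1
    push_cast; ring
  have c3 (h2 : (3 : 𝓞 K) ∈ P) : Submodule.IsPrincipal P := by
    have ht : θ ∈ P := hP.mem_of_pow_mem 3 (by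
      rw [h3, show (6 : 𝓞 K) = 2 * 3 by norm_num]; exact P.mul_mem_left _ h2)
    refine go 3 2 1 ?_ (by norm_num)
    have := P.add_mem h2 (P.mul_mem_left (2 + θ) ht)
    convert this using 1
    push_cast; ring
  have c7 (h2 : (7 : 𝓞 K) ∈ P) : Submodule.IsPrincipal P := by
    have e : (1 + θ) * ((-5 + θ + θ ^ 2) * (7 + 4 * θ + 2 * θ ^ 2)) = 7 := by
      linear_combination (2 * θ ^ 2 + 8 * θ + 7) * h3
    rw [← e] at h2
    rcases hP.mem_or_mem h2 with h2 | h2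
    · exact go 1 1 0 (by simpa using h2) (by norm_num)
    rcases hP.mem_or_mem h2 with h2 | h2
    · exact go (-5) 1 1 (by simpa using h2) (by norm_num)
    · exact go 7 4 2 (by simpa using h2) (by norm_num)
  have c5 (h5 : Ideal.absNorm P = 5) : Submodule.IsPrincipal P := by
    have h2 : (5 : 𝓞 K) ∈ P := by rw [h5] at hmem; exact_mod_cast hmem
    have e : (-1 + θ) * (1 + θ + θ ^ 2) = 5 := by linear_combination h3
    have h2' := h2
    rw [← e] at h2'
    rcases hP.mem_or_mem h2' with h2' | h2'
    · exact go (-1) 1 0 (by simpa using h2') (by norm_num)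
    exfalso
    have hmax : P.IsMaximal := hP.isMaximal h0
    let := Ideal.Quotient.field P
    have hc : Nat.card (𝓞 K ⧸ P) = 5 := by
      rw [← h5, Ideal.absNorm_apply, Submodule.cardQuot_apply]
    have : Finite (𝓞 K ⧸ P) := Nat.finite_of_card_ne_zero (by rw [hc]; norm_num)
    let := Fintype.ofFinite (𝓞 K ⧸ P)
    have hf := FiniteField.pow_card (Ideal.Quotient.mk P θ)
    rw [← Nat.card_eq_fintype_card, hc, ← map_pow, Ideal.Quotient.eq] at hf
    apply hone
    have h6 : θ ^ 5 = 6 * θ ^ 2 := by linear_combination θ ^ 2 * h3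
    rw [h6] at hf
    have h7 : 2 * θ + 1 ∈ P := by
      have := P.add_mem (P.sub_mem h2' hf) (P.mul_mem_left (θ ^ 2) h2)
      convert this using 1
      ring
    have h8 : (3 : 𝓞 K) ∈ P := by
      have := P.sub_mem (P.mul_mem_left 4 h2') (P.mul_mem_left (2 * θ + 1) h7)
      convert this using 1
      ring
    have := P.sub_mem (P.mul_mem_left 2 h8) h2
    convert this using 1
    norm_num
  generalize hn : Ideal.absNorm P = n at *
  interval_cases n
  · exact absurd rfl hn0
  · exact absurd (by simpa using hmem) hone
  · exact c2 (by simpa using hmem)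
  · exact c3 (by simpa using hmem)
  · exact c2 (hP.mem_of_pow_mem 2 (by norm_num at hmem ⊢; exact hmem))
  · exact c5 rfl
  · have : (2 : 𝓞 K) * 3 ∈ P := by norm_num at hmem ⊢; exact hmem
    exact (hP.mem_or_mem this).elim c2 c3
  · exact c7 (by simpa using hmem)
  · exact c2 (hP.mem_of_pow_mem 3 (by norm_num at hmem ⊢; exact hmem))

lemma Good.pid (h : Good θ b) : IsPrincipalIdealRing (𝓞 K) := by
  apply RingOfIntegers.isPrincipalIdealRing_of_isPrincipal_of_norm_le_of_isPrime
  intro I hI hb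
  refine h.principal hI (nonZeroDivisors.coe_ne_zero I) ?_
  have := hb.trans_lt h.minkowski
  exact_mod_cast this

lemma Good.cube (h : Good θ b) (A B C : ℤ) : (A + B * θ + C * θ ^ 2 : 𝓞 K) ^ 3 =
    (A ^ 3 + 6 * B ^ 3 + 36 * C ^ 3 + 36 * A * B * C : ℤ) +
    (3 * (A ^ 2 * B + 6 * B ^ 2 * C + 6 * A * C ^ 2) : ℤ) * θ +
    (3 * (A ^ 2 * C + A * B ^ 2 + 6 * B * C ^ 2) : ℤ) * θ ^ 2 := by
  have h3 := h.1
  have h4 : θ ^ 4 = 6 * θ := by linear_combination θ * h3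
  have h5 : θ ^ 5 = 6 * θ ^ 2 := by linear_combination θ ^ 2 * h3
  have h6 : θ ^ 6 = 36 := by linear_combination (θ ^ 3 + 6) * h3
  push_cast
  ring_nf
  rw [h3, h4, h5, h6]
  ring

lemma Good.not_cube (h : Good θ b) (x : 𝓞 K) : 1 - 6 * θ + 3 * θ ^ 2 ≠ x ^ 3 := by
  intro e
  obtain ⟨A, B, C, rfl⟩ := h.rep x
  rw [h.cube] at e
  have e' := h.inj (p := 1) (q := -6) (r := 3) (by rw [← e]; push_cast; ring)
  obtain ⟨e0, e1, e2⟩ := e'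
  have h7 : (A - B + C) ^ 3 = 10 - 7 * (B ^ 3 + 5 * C ^ 3 + 6 * A * B * C
      - 3 * B ^ 2 * C - 3 * A * C ^ 2 + 3 * B * C ^ 2) := by
    linear_combination -e0 + e1 - e2
  have h8 : (A - B + C) ^ 3 % 7 = 3 := by rw [h7]; omega
  generalize A - B + C = m at h8
  have hm : m % 7 = 0 ∨ m % 7 = 1 ∨ m % 7 = 2 ∨ m % 7 = 3 ∨ m % 7 = 4 ∨ m % 7 = 5 ∨ m % 7 = 6 := by
    omega
  rcases hm with hm | hm | hm | hm | hm | hm | hm <;>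
    simp [pow_succ, Int.mul_emod, hm] at h8

def v (h : Good θ b) : (𝓞 K)ˣ where
  val := 1 - 6 * θ + 3 * θ ^ 2
  inv := 109 + 60 * θ + 33 * θ ^ 2
  val_inv := by linear_combination (99 * θ - 18) * h.1
  inv_val := by linear_combination (99 * θ - 18) * h.1

lemma Good.units (h : Good θ b) (ε : (𝓞 K)ˣ) : ∃ k : ℕ, ∃ δ : (𝓞 K)ˣ, ε = v h ^ k * δ ^ 3 := by
  have hr : Units.rank K = 1 := by
    rw [Units.rank, InfinitePlace.card_eq_nrRealPlaces_add_nrComplexPlaces, h.places.1,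
      h.places.2]
  have hgen : ∃ η : (𝓞 K)ˣ, ∀ u : (𝓞 K)ˣ, ∃ s : (𝓞 K)ˣ, ∃ n : ℤ, s ^ 2 = 1 ∧ u = s * η ^ n := by
    refine ⟨Units.fundSystem K ⟨0, by omega⟩, fun u => ?_⟩
    obtain ⟨⟨ζ, e⟩, he, -⟩ := Units.exist_unique_eq_mul_prod K u
    refine ⟨ζ, e ⟨0, by omega⟩, ?_, ?_⟩
    · rcases Units.torsion_eq_one_or_neg_one_of_odd_finrank
        (by rw [h.finrank]; decide) ζ with h1 | h1 <;> simp [h1]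
    · rw [he]
      congr 1
      have : ∀ i : Fin (Units.rank K), i = ⟨0, by omega⟩ := fun i => by
        ext; have := i.2; simp; omega
      rw [Fintype.prod_eq_single ⟨0, by omega⟩]
      intro i hi
      exact absurd (this i) hi
  obtain ⟨η, hη⟩ := hgen
  obtain ⟨s, m, hs, hm⟩ := hη (v h)
  obtain ⟨t, n, ht, hn⟩ := hη ε
  have s3 : s ^ 3 = s := by rw [pow_succ, hs, one_mul]
  have t3 : t ^ 3 = t := by rw [pow_succ, ht, one_mul]
  have hm3 : ¬ (3 : ℤ) ∣ m := by
    rintro ⟨j, rfl⟩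
    have : v h = (s * η ^ j) ^ 3 := by
      rw [mul_pow, s3, hm, ← zpow_natCast (η ^ j), ← zpow_mul, mul_comm j]; rfl
    exact h.not_cube _ (congrArg Units.val this)
  have hk : ∃ k : ℕ, ∃ j : ℤ, n = m * k + j * 3 := by
    rcases (by omega : m % 3 = 1 ∨ m % 3 = 2) with h1 | h1
    · refine ⟨(n % 3).toNat, (n - m * (n % 3)) / 3, ?_⟩
      have : (3 : ℤ) ∣ n - m * (n % 3) := by
        rcases (by omega : n % 3 = 0 ∨ n % 3 = 1 ∨ n % 3 = 2) with h2 | h2 | h2 <;>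
          rw [h2] <;> omega
      rw [Int.toNat_of_nonneg (by omega)]
      omega
    · refine ⟨(-n % 3).toNat, (n - m * (-n % 3)) / 3, ?_⟩
      have : (3 : ℤ) ∣ n - m * (-n % 3) := by
        rcases (by omega : -n % 3 = 0 ∨ -n % 3 = 1 ∨ -n % 3 = 2) with h2 | h2 | h2 <;>
          rw [h2] <;> omega
      rw [Int.toNat_of_nonneg (by omega)]
      omega
  obtain ⟨k, j, hkj⟩ := hk
  refine ⟨k, t * s ^ k * η ^ j, ?_⟩
  have e1 : (η ^ j) ^ 3 = η ^ (j * 3) := by rw [zpow_mul]; rfl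
  have e2 : (s ^ k) ^ 3 = s ^ k := by rw [← pow_mul, mul_comm, pow_mul, s3]
  have e3 : s ^ k * s ^ k = 1 := by rw [← mul_pow, ← sq, hs, one_pow]
  rw [mul_pow, mul_pow, t3, e1, e2, hn, hkj, hm, zpow_add, zpow_mul, mul_pow, zpow_natCast]
  calc t * ((η ^ m) ^ k * η ^ (j * 3)) = t * ((η ^ m) ^ k * η ^ (j * 3)) * (s ^ k * s ^ k) := by
        rw [e3, mul_one]
    _ = _ := by
        simp only [mul_assoc, mul_left_comm, mul_comm]

lemma local_three {p q r A B C : ℤ} (hr : ¬ 3 ∣ r)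
    (e : p * (3 * (A ^ 2 * C + A * B ^ 2 + 6 * B * C ^ 2)) +
      q * (3 * (A ^ 2 * B + 6 * B ^ 2 * C + 6 * A * C ^ 2)) +
      r * (A ^ 3 + 6 * B ^ 3 + 36 * C ^ 3 + 36 * A * B * C) = 0) :
    3 ∣ A ∧ 3 ∣ B ∧ 3 ∣ C := by
  have hp : Prime (3 : ℤ) := Int.prime_three
  have key (X : ℤ) (h : 3 ∣ r * X ^ 3) : 3 ∣ X :=
    hp.dvd_of_dvd_pow ((hp.dvd_or_dvd h).resolve_left hr)
  have hA : 3 ∣ A := key A ⟨-(p * (A ^ 2 * C + A * B ^ 2 + 6 * B * C ^ 2) +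
    q * (A ^ 2 * B + 6 * B ^ 2 * C + 6 * A * C ^ 2) +
    r * (2 * B ^ 3 + 12 * C ^ 3 + 12 * A * B * C)), by linear_combination e⟩
  obtain ⟨A, rfl⟩ := hA
  have hB : 3 ∣ B := key B ⟨p * (3 * A ^ 2 * C + A * B ^ 2 + 2 * B * C ^ 2) +
    q * (3 * A ^ 2 * B + 2 * B ^ 2 * C + 6 * A * C ^ 2) +
    r * (3 * A ^ 3 + B ^ 3 + 4 * C ^ 3 + 12 * A * B * C), by linarith⟩
  obtain ⟨B, rfl⟩ := hB
  have hC : 3 ∣ C := key C ⟨-(p * (A ^ 2 * C + 3 * A * B ^ 2 + 2 * B * C ^ 2) +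
    q * (3 * A ^ 2 * B + 6 * B ^ 2 * C + 2 * A * C ^ 2) +
    r * (A ^ 3 + 6 * B ^ 3 + C ^ 3 + 12 * A * B * C)), by linarith⟩
  exact ⟨dvd_mul_right _ _, dvd_mul_right _ _, hC⟩

lemma Good.final (h : Good θ b) {x y : ℤ} (hxy : IsCoprime x y) (k : ℕ) (γ : 𝓞 K)
    (e : (2 * y + x * θ : 𝓞 K) = (-2 + 3 * θ - θ ^ 2) * (1 - 6 * θ + 3 * θ ^ 2) ^ k * γ ^ 3) :
    False := by
  have h3 := h.1
  have hv : ∃ w : 𝓞 K, (1 - 6 * θ + 3 * θ ^ 2) ^ k = 1 + 3 * w := by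
    induction k with
    | zero => exact ⟨0, by simp⟩
    | succ n ih =>
      clear e
      have : ∃ w : 𝓞 K, (1 - 6 * θ + 3 * θ ^ 2) ^ n = 1 + 3 * w := by
        have d : (1 - 6 * θ + 3 * θ ^ 2) - 1 ∣ (1 - 6 * θ + 3 * θ ^ 2) ^ n - 1 :=
          sub_one_dvd_pow_sub_one _ _
        obtain ⟨c, hc⟩ := d
        exact ⟨(-2 * θ + θ ^ 2) * c, by linear_combination hc⟩
      obtain ⟨w, hw⟩ := this
      exact ⟨w + (-2 * θ + θ ^ 2) * (1 + 3 * w), by rw [pow_succ, hw]; ring⟩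
  obtain ⟨w, hw⟩ := hv
  obtain ⟨p, q, r, hl⟩ := h.rep ((-2 + 3 * θ - θ ^ 2) * w)
  obtain ⟨A, B, C, rfl⟩ := h.rep γ
  have hl' : (-2 + 3 * θ - θ ^ 2) * (1 - 6 * θ + 3 * θ ^ 2) ^ k =
      (-2 + 3 * p : ℤ) + (3 + 3 * q : ℤ) * θ + (-1 + 3 * r : ℤ) * θ ^ 2 := by
    rw [hw]; push_cast; linear_combination 3 * hl
  rw [hl'] at e
  have e2 := e
  rw [h.cube] at e2
  generalize hP : A ^ 3 + 6 * B ^ 3 + 36 * C ^ 3 + 36 * A * B * C = P at e2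
  generalize hQ : 3 * (A ^ 2 * B + 6 * B ^ 2 * C + 6 * A * C ^ 2) = Q at e2
  generalize hR : 3 * (A ^ 2 * C + A * B ^ 2 + 6 * B * C ^ 2) = R at e2
  have e3 := h.inj (p := 2 * y) (q := x) (r := 0)
    (p' := (-2 + 3 * p) * P + 6 * ((3 + 3 * q) * R + (-1 + 3 * r) * Q))
    (q' := (-2 + 3 * p) * Q + (3 + 3 * q) * P + 6 * ((-1 + 3 * r) * R))
    (r' := (-2 + 3 * p) * R + (3 + 3 * q) * Q + (-1 + 3 * r) * P) (by
      push_cast at e2 ⊢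
      linear_combination e2 + ((3 + 3 * q) * R + (-1 + 3 * r) * Q + (-1 + 3 * r) * R * θ : 𝓞 K) * h3)
  obtain ⟨c0, c1, c2⟩ := e3
  obtain ⟨dA, dB, dC⟩ := local_three (p := -2 + 3 * p) (q := 3 + 3 * q) (r := -1 + 3 * r)
    (A := A) (B := B) (C := C) (by omega) (by rw [hP, hQ, hR]; exact c2.symm)
  obtain ⟨A, rfl⟩ := dA
  obtain ⟨B, rfl⟩ := dB
  obtain ⟨C, rfl⟩ := dC
  have dP : 3 ∣ P := ⟨9 * (A ^ 3 + 6 * B ^ 3 + 36 * C ^ 3 + 36 * A * B * C), by rw [← hP]; ring⟩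
  have dQ : 3 ∣ Q := ⟨_, hQ.symm⟩
  have dR : 3 ∣ R := ⟨_, hR.symm⟩
  have dx : 3 ∣ x := by
    rw [c1]
    exact dvd_add (dvd_add (dvd_mul_of_dvd_right dQ _) (dvd_mul_of_dvd_right dP _))
      (dvd_mul_of_dvd_right (dvd_mul_of_dvd_right dR _) _)
  have dy : 3 ∣ 2 * y := by
    rw [c0]
    exact dvd_add (dvd_mul_of_dvd_right dP _) (dvd_mul_of_dvd_right
      (dvd_add (dvd_mul_of_dvd_right dR _) (dvd_mul_of_dvd_right dQ _)) _)
  have := hxy.isUnit_of_dvd' dx (show 3 ∣ y by omega)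
  exact Int.prime_three.not_isUnit this

end

lemma coprime_z {x y z : ℤ} (hxy : IsCoprime x y) (e : 3 * x ^ 3 + 4 * y ^ 3 + 5 * z ^ 3 = 0) :
    IsCoprime z (6 * x) := by
  have nd {p : ℤ} (hp : Prime p) (h1 : p ∣ x) (h2 : p ∣ y) : False :=
    hp.not_isUnit (hxy.isUnit_of_dvd' h1 h2)
  have h2 : ¬ 2 ∣ z := by
    rintro ⟨z, rfl⟩
    have hp := Int.prime_two
    have hx : 2 ∣ x := by
      have : 2 ∣ 3 * x ^ 3 := ⟨-(2 * y ^ 3 + 20 * z ^ 3), by linarith⟩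
      exact hp.dvd_of_dvd_pow ((hp.dvd_or_dvd this).resolve_left (by norm_num))
    obtain ⟨x', rfl⟩ := hx
    have : 2 ∣ y ^ 3 := ⟨-(3 * x' ^ 3 + 5 * z ^ 3), by linarith⟩
    exact nd hp (dvd_mul_right _ _) (hp.dvd_of_dvd_pow this)
  have h3 : ¬ 3 ∣ z := by
    rintro ⟨z, rfl⟩
    have hp := Int.prime_three
    have hy : 3 ∣ y := by
      have : 3 ∣ 4 * y ^ 3 := ⟨-(x ^ 3 + 45 * z ^ 3), by linarith⟩
      exact hp.dvd_of_dvd_pow ((hp.dvd_or_dvd this).resolve_left (by norm_num))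
    obtain ⟨y', rfl⟩ := hy
    have : 3 ∣ x ^ 3 := ⟨-(12 * y' ^ 3 + 15 * z ^ 3), by linarith⟩
    exact nd hp (hp.dvd_of_dvd_pow this) (dvd_mul_right _ _)
  apply isCoprime_of_prime_dvd
  · rintro ⟨rfl, -⟩; simp at h2
  · intro p hp hz h6
    have a2 : ¬ p ∣ 2 := fun h => h2 ((hp.associated_of_dvd Int.prime_two h).symm.dvd.trans hz)
    have a3 : ¬ p ∣ 3 := fun h => h3 ((hp.associated_of_dvd Int.prime_three h).symm.dvd.trans hz)
    have hx : p ∣ x := by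
      refine (hp.dvd_or_dvd h6).resolve_left fun h => ?_
      rw [show (6 : ℤ) = 2 * 3 by norm_num] at h
      exact (hp.dvd_or_dvd h).elim a2 a3
    have hy : p ∣ 2 * (2 * y ^ 3) := by
      have : 2 * (2 * y ^ 3) = -(3 * x ^ 3) - 5 * z ^ 3 := by linarith
      rw [this]
      exact dvd_sub (dvd_neg.2 (dvd_mul_of_dvd_right (dvd_pow hx (by norm_num)) _))
        (dvd_mul_of_dvd_right (dvd_pow hz (by norm_num)) _)
    have hy := (hp.dvd_or_dvd ((hp.dvd_or_dvd hy).resolve_left a2)).resolve_left a2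
    exact nd hp hx (hp.dvd_of_dvd_pow hy)

lemma dvd_five {x y z : ℤ} (e : 3 * x ^ 3 + 4 * y ^ 3 + 5 * z ^ 3 = 0) :
    ∃ t, x = 5 * t - 2 * y := by
  have h : (3 * x ^ 3 + 4 * y ^ 3) % 5 = 0 := by omega
  have hx : x % 5 = 0 ∨ x % 5 = 1 ∨ x % 5 = 2 ∨ x % 5 = 3 ∨ x % 5 = 4 := by omega
  have hy : y % 5 = 0 ∨ y % 5 = 1 ∨ y % 5 = 2 ∨ y % 5 = 3 ∨ y % 5 = 4 := by omega
  have : (x + 2 * y) % 5 = 0 := by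
    rcases hx with hx | hx | hx | hx | hx <;> rcases hy with hy | hy | hy | hy | hy <;>
      simp [pow_succ, Int.mul_emod, Int.add_emod, hx, hy] at h ⊢
  exact ⟨(x + 2 * y) / 5, by omega⟩

lemma core {x y z : ℤ} (hxy : IsCoprime x y) (e : 3 * x ^ 3 + 4 * y ^ 3 + 5 * z ^ 3 = 0) :
    False := by
  obtain ⟨K, _, _, θ, b, h⟩ := exists_field
  have h : Good θ b := h
  have h3 := h.1
  have := h.pid
  have hz := coprime_z hxy e
  obtain ⟨t, ht⟩ := dvd_five e
  have ht' : (x : 𝓞 K) = 5 * t - 2 * y := by rw [ht]; push_cast; ring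
  set p : ℤ := 21 * t - 4 * y with hp
  set q : ℤ := 11 * t - 2 * y with hq
  set r : ℤ := 6 * t - y with hr
  have hN : p ^ 3 + 6 * q ^ 3 + 36 * r ^ 3 - 18 * p * q * r = (-z) ^ 3 := by
    have : 5 * (p ^ 3 + 6 * q ^ 3 + 36 * r ^ 3 - 18 * p * q * r) = 5 * (-z) ^ 3 := by
      rw [ht] at e
      rw [hp, hq, hr]
      linear_combination e
    linarith
  have hN' := congrArg (Int.cast : ℤ → 𝓞 K) hN
  push_cast at hN'
  set α : 𝓞 K := p + q * θ + r * θ ^ 2 with hα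
  set β : 𝓞 K := (p ^ 2 - 6 * q * r) + (6 * r ^ 2 - p * q) * θ + (q ^ 2 - p * r) * θ ^ 2 with hβ
  have hprod : α * β = (-z : 𝓞 K) ^ 3 := by
    rw [← hN', hα, hβ]
    linear_combination ((q * (q ^ 2 - p * r) + r * (6 * r ^ 2 - p * q)) +
      r * (q ^ 2 - p * r) * θ : 𝓞 K) * h3
  have hA : (2 * y + x * θ : 𝓞 K) = (-2 + 3 * θ - θ ^ 2) * α := by
    rw [hα, ht', hp, hq, hr]
    push_cast
    linear_combination (-7 * t + y + (6 * t - y) * θ : 𝓞 K) * h3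
  have hB : ((2 * y) ^ 2 - 2 * y * x * θ + x ^ 2 * θ ^ 2 : 𝓞 K) =
      (22 + 12 * θ + 7 * θ ^ 2) * β := by
    rw [hβ, ht', hp, hq, hr]
    push_cast
    linear_combination -(12 * ((11 * t - 2 * y) ^ 2 - (21 * t - 4 * y) * (6 * t - y)) + 7 * (6 * (6 * t - y) ^ 2 - (21 * t - 4 * y) * (11 * t - 2 * y)) +
      7 * ((11 * t - 2 * y) ^ 2 - (21 * t - 4 * y) * (6 * t - y)) * θ : 𝓞 K) * h3
  have hcop : IsCoprime α β := by
    apply isCoprime_of_prime_dvd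
    · rintro ⟨h0, -⟩
      rw [h0, zero_mul] at hprod
      have : (z : 𝓞 K) = 0 := by
        have := pow_eq_zero_iff (n := 3) (by norm_num) |>.1 hprod.symm
        simpa using this
      have hz0 : z = 0 := by exact_mod_cast this
      rw [hz0, isCoprime_zero_left] at hz
      have := Int.isUnit_iff.1 hz
      omega
    · intro π hπ ha hb
      have dz : π ∣ (z : 𝓞 K) := by
        have : π ∣ (-z : 𝓞 K) ^ 3 := by rw [← hprod]; exact dvd_mul_of_dvd_left ha _
        exact (dvd_neg.1 (hπ.dvd_of_dvd_pow this))
      have d6 : π ∣ ((6 * x : ℤ) : 𝓞 K) := by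
        apply hπ.dvd_of_dvd_pow (n := 2)
        have : (((6 * x : ℤ) : 𝓞 K)) ^ 2 = 2 * θ * ((22 + 12 * θ + 7 * θ ^ 2) * β
            - (2 * y - 2 * x * θ) * ((-2 + 3 * θ - θ ^ 2) * α)) := by
          rw [← hA, ← hB]
          push_cast
          linear_combination (-6 * x ^ 2 : 𝓞 K) * h3
        rw [this]
        exact dvd_mul_of_dvd_right (dvd_sub (dvd_mul_of_dvd_right hb _)
          (dvd_mul_of_dvd_right (dvd_mul_of_dvd_right ha _) _)) _
      have := (hz.map (Int.castRingHom (𝓞 K))).isUnit_of_dvd' (by simpa using dz) (by simpa using d6)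
      exact hπ.not_isUnit this
  obtain ⟨d, ε, hd⟩ := exists_associated_pow_of_mul_eq_pow' hcop hprod
  obtain ⟨k, δ, hk⟩ := h.units ε
  apply h.final hxy k (d * δ)
  rw [hA, ← hd, hk]
  simp only [Units.val_mul, Units.val_pow_eq_pow_val, v]
  ring

lemma int_case (x y z : ℤ) (e : 3 * x ^ 3 + 4 * y ^ 3 + 5 * z ^ 3 = 0) :
    x = 0 ∧ y = 0 ∧ z = 0 := by
  by_cases h0 : x = 0 ∧ y = 0
  · obtain ⟨rfl, rfl⟩ := h0
    simpa using e
  exfalso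
  have hg : 0 < Int.gcd x y := Int.gcd_pos_iff.2 (by tauto)
  obtain ⟨x', y', hc, hx, hy⟩ := Int.exists_gcd_one hg
  set g : ℤ := (Int.gcd x y : ℤ) with hgdef
  have hg0 : g ≠ 0 := by rw [hgdef]; exact_mod_cast hg.ne'
  rw [hx, hy] at e
  have h1 : g ∣ 5 * z := by
    rw [← Int.pow_dvd_pow_iff (n := 3) (by norm_num)]
    exact ⟨-25 * (3 * x' ^ 3 + 4 * y' ^ 3), by linear_combination 25 * e⟩
  obtain ⟨m, hm⟩ := h1
  have h2 : m ^ 3 = -25 * (3 * x' ^ 3 + 4 * y' ^ 3) := by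
    apply mul_left_cancel₀ (pow_ne_zero 3 hg0)
    have : (5 * z) ^ 3 = (g * m) ^ 3 := by rw [hm]
    linear_combination 25 * e - this
  have h3 : (5 : ℤ) ∣ m := by
    have hp : Prime (5 : ℤ) := by norm_num
    exact hp.dvd_of_dvd_pow (n := 3) ⟨-5 * (3 * x' ^ 3 + 4 * y' ^ 3), by rw [h2]; ring⟩
  obtain ⟨w, rfl⟩ := h3
  exact core (z := w) (Int.isCoprime_iff_gcd_eq_one.2 hc) (by linarith)

end Selmer



/-- Selmer's example: The only integer solution of `3x³ + 4y³ + 5z³ = 0` is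
`x = y = z = 0`; equivalently, the Selmer curve `3X³ + 4Y³ + 5Z³ = 0` has no rational
projective point. -/
theorem selmer_curve_no_rational_points :
    (∀ x y z : ℤ, 3 * x ^ 3 + 4 * y ^ 3 + 5 * z ^ 3 = 0 → x = 0 ∧ y = 0 ∧ z = 0) ∧
    ¬ ∃ x y z : ℚ, (x, y, z) ≠ (0, 0, 0) ∧ 3 * x ^ 3 + 4 * y ^ 3 + 5 * z ^ 3 = 0 := by
  refine ⟨Selmer.int_case, ?_⟩
  rintro ⟨x, y, z, hne, e⟩
  have hx := Rat.den_nz x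
  have hy := Rat.den_nz y
  have hz := Rat.den_nz z
  have hx' : (x.den : ℚ) ≠ 0 := by exact_mod_cast hx
  have hy' : (y.den : ℚ) ≠ 0 := by exact_mod_cast hy
  have hz' : (z.den : ℚ) ≠ 0 := by exact_mod_cast hz
  have ex : (x.num : ℚ) = x * x.den := (Rat.mul_den_eq_num x).symm
  have ey : (y.num : ℚ) = y * y.den := (Rat.mul_den_eq_num y).symm
  have ez : (z.num : ℚ) = z * z.den := (Rat.mul_den_eq_num z).symm
  have key := Selmer.int_case (x.num * y.den * z.den) (y.num * x.den * z.den)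
    (z.num * x.den * y.den) (by
      have : (3 * (x.num * y.den * z.den) ^ 3 + 4 * (y.num * x.den * z.den) ^ 3
          + 5 * (z.num * x.den * y.den) ^ 3 : ℚ) = 0 := by
        rw [ex, ey, ez]
        linear_combination (x.den * y.den * z.den : ℚ) ^ 3 * e
      exact_mod_cast this)
  apply hne
  simpa [hx, hy, hz] using key
end

section
/- For every prime number p there exists (x, y, z) ∈ ℚ_p³ with (x, y, z) ≠ (0, 0, 0) and 3x³ + 4y³ + 5z³ = 0; likewise there exists such a nonzero triple in ℝ³. -/
theorem selmer_cyclic {G : Type*} [Group G] [IsCyclic G] (a b c : G) :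
    ∃ t : G, t ^ 3 = a ∨ t ^ 3 = b ∨ c * t ^ 3 = 1 ∨ a * t ^ 3 = b ^ 2 ∨ a * t ^ 3 = c ∨
      b ^ 2 * t ^ 3 = c := by
  obtain ⟨g, hg⟩ := IsCyclic.exists_generator (α := G)
  obtain ⟨i, rfl⟩ := Subgroup.mem_zpowers_iff.1 (hg a)
  obtain ⟨j, rfl⟩ := Subgroup.mem_zpowers_iff.1 (hg b)
  obtain ⟨k, rfl⟩ := Subgroup.mem_zpowers_iff.1 (hg c)
  have key : ∃ m : ℤ, m * 3 = i ∨ m * 3 = j ∨ k + m * 3 = 0 ∨ i + m * 3 = j * 2 ∨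
      i + m * 3 = k ∨ j * 2 + m * 3 = k := by
    have h : i % 3 = 0 ∨ j % 3 = 0 ∨ k % 3 = 0 ∨ (j * 2 - i) % 3 = 0 ∨ (k - i) % 3 = 0 ∨
      (k - j * 2) % 3 = 0 := by
      have hi : i % 3 = 0 ∨ i % 3 = 1 ∨ i % 3 = 2 := by omega
      have hj : j % 3 = 0 ∨ j % 3 = 1 ∨ j % 3 = 2 := by omega
      have hk : k % 3 = 0 ∨ k % 3 = 1 ∨ k % 3 = 2 := by omega
      rcases hi with hi | hi | hi <;> rcases hj with hj | hj | hj <;>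
        rcases hk with hk | hk | hk <;> omega
    rcases h with h | h | h | h | h | h
    · exact ⟨i / 3, by omega⟩
    · exact ⟨j / 3, by omega⟩
    · exact ⟨-(k / 3), by omega⟩
    · exact ⟨(j * 2 - i) / 3, by omega⟩
    · exact ⟨(k - i) / 3, by omega⟩
    · exact ⟨(k - j * 2) / 3, by omega⟩
  obtain ⟨m, hm⟩ := key
  refine ⟨g ^ m, ?_⟩
  have e3 : (g ^ m) ^ 3 = g ^ (m * 3) := by rw [zpow_mul]; norm_cast
  have e2 : (g ^ j) ^ 2 = g ^ (j * 2) := by rw [zpow_mul]; norm_cast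
  rw [e3, e2, ← zpow_add, ← zpow_add, ← zpow_add]
  rcases hm with h | h | h | h | h | h <;> rw [h] <;> simp

theorem selmer_hensel_norm (p : ℕ) [Fact p.Prime] (u v a : ℤ)
    (h : ‖((u * a ^ 3 + v : ℤ) : ℤ_[p])‖ < ‖((u * (3 * a ^ 2) : ℤ) : ℤ_[p])‖ ^ 2) :
    ∃ z : ℚ_[p], (u : ℚ_[p]) * z ^ 3 + v = 0 := by
  let F : Polynomial ℤ_[p] := Polynomial.C (u : ℤ_[p]) * Polynomial.X ^ 3 + Polynomial.C (v : ℤ_[p])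
  have hF : ‖F.aeval (a : ℤ_[p])‖ < ‖F.derivative.aeval (a : ℤ_[p])‖ ^ 2 := by
    convert h using 3
    · simp [F]
    · simp [F]; norm_num
  obtain ⟨z, hz, -⟩ := hensels_lemma hF
  refine ⟨z, ?_⟩
  have : (u : ℤ_[p]) * z ^ 3 + v = 0 := by simpa [F] using hz
  exact_mod_cast congrArg (fun t : ℤ_[p] => (t : ℚ_[p])) this

theorem selmer_hensel_int (p : ℕ) [hp : Fact p.Prime] (u v a : ℤ)
    (h : ¬ (p : ℤ) ∣ u * (3 * a ^ 2)) (ht : (p : ℤ) ∣ u * a ^ 3 + v) :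
    ∃ z : ℚ_[p], (u : ℚ_[p]) * z ^ 3 + v = 0 := by
  apply selmer_hensel_norm p u v a
  have h1 : ‖((u * a ^ 3 + v : ℤ) : ℤ_[p])‖ < 1 := by
    rwa [PadicInt.norm_int_lt_one_iff_dvd]
  have h2 : ‖((u * (3 * a ^ 2) : ℤ) : ℤ_[p])‖ = 1 := by
    refine le_antisymm (PadicInt.norm_le_one _) (not_lt.1 ?_)
    rwa [PadicInt.norm_int_lt_one_iff_dvd]
  rw [h2]; simpa using h1

theorem selmer_hensel (p : ℕ) [hp : Fact p.Prime] (u v : ℤ) (h3 : (3 : ZMod p) ≠ 0)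
    (hu : (u : ZMod p) ≠ 0) (hv : (v : ZMod p) ≠ 0) (t : ZMod p)
    (ht : (u : ZMod p) * t ^ 3 + v = 0) :
    ∃ z : ℚ_[p], (u : ℚ_[p]) * z ^ 3 + v = 0 := by
  obtain ⟨a, rfl⟩ := ZMod.intCast_surjective t
  have ha : (a : ZMod p) ≠ 0 := by
    intro h
    apply hv
    simpa [h] using ht
  apply selmer_hensel_int p u v a
  · rw [← ZMod.intCast_zmod_eq_zero_iff_dvd]
    push_cast
    exact mul_ne_zero hu (mul_ne_zero h3 (pow_ne_zero _ ha))
  · rw [← ZMod.intCast_zmod_eq_zero_iff_dvd]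
    exact_mod_cast ht

theorem selmer_padic (p : ℕ) [hp : Fact p.Prime] : ∃ x y z : ℚ_[p], (x, y, z) ≠ (0, 0, 0) ∧
      3 * x ^ 3 + 4 * y ^ 3 + 5 * z ^ 3 = 0 := by
  by_cases p2 : p = 2
  · subst p2
    obtain ⟨z, hz⟩ := selmer_hensel_int 2 3 5 1 (by norm_num) (by norm_num)
    push_cast at hz
    exact ⟨z, 0, 1, by simp, by linear_combination hz⟩
  by_cases p5 : p = 5
  · subst p5
    obtain ⟨z, hz⟩ := selmer_hensel_int 5 3 4 3 (by norm_num) (by norm_num)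
    push_cast at hz
    exact ⟨z, 1, 0, by simp, by linear_combination hz⟩
  by_cases p3 : p = 3
  · subst p3
    obtain ⟨z, hz⟩ := selmer_hensel_norm 3 4 5 (-2) (by
      have e1 : ((4 * (-2) ^ 3 + 5 : ℤ) : ℤ_[3]) = -((3 : ℕ) : ℤ_[3]) ^ 3 := by norm_num
      have h16 : ‖((16 : ℤ) : ℤ_[3])‖ = 1 := by
        refine le_antisymm (PadicInt.norm_le_one _) (not_lt.1 ?_)
        rw [PadicInt.norm_int_lt_one_iff_dvd]
        norm_num
      have e2 : ((4 * (3 * (-2) ^ 2) : ℤ) : ℤ_[3]) = ((3 : ℕ) : ℤ_[3]) * ((16 : ℤ) : ℤ_[3]) := by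
        norm_num
      rw [e1, e2, norm_neg, norm_pow, norm_mul, h16, PadicInt.norm_p]
      norm_num)
    push_cast at hz
    exact ⟨0, z, 1, by simp, by linear_combination hz⟩
  have hne : ∀ q : ℕ, q.Prime → p ≠ q → (q : ZMod p) ≠ 0 := by
    intro q hq hpq h
    rw [ZMod.natCast_eq_zero_iff] at h
    exact hpq ((Nat.prime_dvd_prime_iff_eq hp.out hq).1 h)
  have n2 : (2 : ZMod p) ≠ 0 := by exact_mod_cast hne 2 (by norm_num) p2
  have n3 : (3 : ZMod p) ≠ 0 := by exact_mod_cast hne 3 (by norm_num) p3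
  have n5 : (5 : ZMod p) ≠ 0 := by exact_mod_cast hne 5 (by norm_num) p5
  have n4 : (4 : ZMod p) ≠ 0 := by
    have : (4 : ZMod p) = 2 * 2 := by norm_num
    rw [this]; exact mul_ne_zero n2 n2
  obtain ⟨t, ht⟩ := selmer_cyclic (Units.mk0 _ n3) (Units.mk0 _ n2) (Units.mk0 _ n5)
  simp only [Units.ext_iff, Units.val_mul, Units.val_pow_eq_pow_val, Units.val_mk0,
    Units.val_one] at ht
  rcases ht with h | h | h | h | h | h
  · obtain ⟨z, hz⟩ := selmer_hensel p 1 3 n3 (by simp) (by simpa using n3) (-t)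
      (by push_cast; linear_combination -h)
    push_cast at hz
    exact ⟨z, 1, 1, by simp, by linear_combination 3 * hz⟩
  · obtain ⟨z, hz⟩ := selmer_hensel p 1 2 n3 (by simp) (by simpa using n2) (-t)
      (by push_cast; linear_combination -h)
    push_cast at hz
    exact ⟨1, z, 1, by simp, by linear_combination 4 * hz⟩
  · obtain ⟨z, hz⟩ := selmer_hensel p 5 (-1) n3 (by simpa using n5) (by simp) t
      (by push_cast; linear_combination h)
    push_cast at hz
    exact ⟨1, -1, z, by simp, by linear_combination hz⟩
  · obtain ⟨z, hz⟩ := selmer_hensel p 3 4 n3 (by simpa using n3) (by simpa using n4) (-t)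
      (by push_cast; linear_combination -h)
    push_cast at hz
    exact ⟨z, 1, 0, by simp, by linear_combination hz⟩
  · obtain ⟨z, hz⟩ := selmer_hensel p 3 5 n3 (by simpa using n3) (by simpa using n5) (-t)
      (by push_cast; linear_combination -h)
    push_cast at hz
    exact ⟨z, 0, 1, by simp, by linear_combination hz⟩
  · obtain ⟨z, hz⟩ := selmer_hensel p 4 5 n3 (by simpa using n4) (by simpa using n5) (-t)
      (by push_cast; linear_combination -h)
    push_cast at hz
    exact ⟨0, z, 1, by simp, by linear_combination hz⟩

/-- local solvability of the Selmer curve: For every prime `p` the equation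
`3x³ + 4y³ + 5z³ = 0` has a nontrivial solution in `ℚ_p`, and likewise in `ℝ`. -/
theorem selmer_curve_local_solvability :
    (∀ (p : ℕ) [Fact p.Prime], ∃ x y z : ℚ_[p], (x, y, z) ≠ (0, 0, 0) ∧
      3 * x ^ 3 + 4 * y ^ 3 + 5 * z ^ 3 = 0) ∧
    (∃ x y z : ℝ, (x, y, z) ≠ (0, 0, 0) ∧ 3 * x ^ 3 + 4 * y ^ 3 + 5 * z ^ 3 = 0) := by
  refine ⟨fun p _ => selmer_padic p, ?_⟩
  have h : ((5 / 4 : ℝ) ^ (((3 : ℕ) : ℝ)⁻¹)) ^ 3 = 5 / 4 :=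
    Real.rpow_inv_natCast_pow (by norm_num) (by norm_num)
  exact ⟨0, -((5 / 4 : ℝ) ^ (((3 : ℕ) : ℝ)⁻¹)), 1, by simp, by linear_combination -4 * h⟩
end

section
/- Let a, b, c be nonzero rational numbers. Suppose the equation a·x² + b·y² + c·z² = 0 has a solution (x, y, z) ≠ (0, 0, 0) with coordinates in ℝ, and for every prime number p it has a solution (x, y, z) ≠ (0, 0, 0) with coordinates in ℚ_p. Then it has a solution (x, y, z) ≠ (0, 0, 0) with coordinates in ℚ. -/
/-- Nontrivial solvability of `z² = a x² + b y²`. -/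
def TSol (K : Type) [Field K] (a b : K) : Prop :=
  ∃ x y z : K, (x ≠ 0 ∨ y ≠ 0 ∨ z ≠ 0) ∧ z ^ 2 = a * x ^ 2 + b * y ^ 2

lemma TSol.symm {K : Type} [Field K] {a b : K} (h : TSol K a b) : TSol K b a := by
  obtain ⟨x, y, z, h0, h⟩ := h
  exact ⟨y, x, z, by tauto, by rw [h]; ring⟩

lemma TSol.of_mul_sq {K : Type} [Field K] {a b k : K} (hk : k ≠ 0)
    (h : TSol K a (b * k ^ 2)) : TSol K a b := by
  obtain ⟨x, y, z, h0, h⟩ := h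
  refine ⟨x, k * y, z, ?_, by rw [h]; ring⟩
  rcases h0 with h0 | h0 | h0
  · exact Or.inl h0
  · exact Or.inr (Or.inl (mul_ne_zero hk h0))
  · exact Or.inr (Or.inr h0)

lemma TSol.mul_sq {K : Type} [Field K] {a b k : K} (hk : k ≠ 0)
    (h : TSol K a b) : TSol K a (b * k ^ 2) := by
  apply TSol.of_mul_sq (k := k⁻¹) (inv_ne_zero hk)
  have : b * k ^ 2 * k⁻¹ ^ 2 = b := by field_simp
  rwa [this]

lemma TSol.trade {K : Type} [Field K] {a b c t : K} (hb : b ≠ 0)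
    (e : t ^ 2 - a = b * c) (h : TSol K a b) : TSol K a c := by
  obtain ⟨x, y, z, h0, h⟩ := h
  by_cases hy : y = 0
  · subst hy
    exact ⟨x, 0, z, h0, by rw [h]; ring⟩
  · refine ⟨t * x + z, b * y, t * z + a * x, Or.inr (Or.inl (mul_ne_zero hb hy)), ?_⟩
    linear_combination (t ^ 2 - a) * h + b * y ^ 2 * e

lemma isSquare_of_primes (a : ℤ) (n : ℕ) (hn : Squarefree n)
    (h : ∀ p : ℕ, p.Prime → p ∣ n → ∃ t : ℤ, (p : ℤ) ∣ t ^ 2 - a) :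
    ∃ t : ℤ, (n : ℤ) ∣ t ^ 2 - a := by
  induction n using Nat.recOnMul with
  | zero => simp at hn
  | one => exact ⟨0, by simp⟩
  | prime p hp => exact h p hp dvd_rfl
  | mul m k ihm ihk =>
    have hco : Nat.Coprime m k := Nat.coprime_of_squarefree_mul hn
    obtain ⟨t, ht⟩ := ihm (hn.of_mul_left) (fun p hp hd => h p hp (hd.mul_right _))
    obtain ⟨s, hs⟩ := ihk (hn.of_mul_right) (fun p hp hd => h p hp (hd.mul_left _))
    have hco' : IsCoprime (m : ℤ) (k : ℤ) := Nat.isCoprime_iff_coprime.mpr hco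
    obtain ⟨u, v, huv⟩ := hco'
    refine ⟨t * (v * k) + s * (u * m), ?_⟩
    push_cast
    apply IsCoprime.mul_dvd ⟨u, v, huv⟩
    · have e : (t * (v * k) + s * (u * m)) ^ 2 - a =
          (t ^ 2 - a) + m * (u * (s - t) * (t * (v * k) + s * (u * m) + t)) := by
        have : v * k = 1 - u * m := by linarith
        rw [this]; ring
      rw [e]; exact dvd_add ht (dvd_mul_right _ _)
    · have e : (t * (v * k) + s * (u * m)) ^ 2 - a =
          (s ^ 2 - a) + k * (v * (t - s) * (t * (v * k) + s * (u * m) + s)) := by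
        have : u * m = 1 - v * k := by linarith
        rw [this]; ring
      rw [e]; exact dvd_add hs (dvd_mul_right _ _)

lemma padic_parity {p : ℕ} [Fact p.Prime] {b y z : ℚ_[p]} (hb : b.valuation = 1) (hy : y ≠ 0)
    (h : ‖z ^ 2‖ = ‖b * y ^ 2‖) : False := by
  have hb0 : b ≠ 0 := by rintro rfl; simp at hb
  have hz : z ≠ 0 := by
    rintro rfl
    simp [hb0, hy] at h
  have hp1 : (1 : ℝ) < p := by exact_mod_cast (Fact.out : p.Prime).one_lt
  rw [Padic.norm_eq_zpow_neg_valuation (pow_ne_zero 2 hz),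
    Padic.norm_eq_zpow_neg_valuation (mul_ne_zero hb0 (pow_ne_zero 2 hy))] at h
  have := zpow_right_injective₀ (by linarith) hp1.ne' h
  rw [Padic.valuation_mul hb0 (pow_ne_zero 2 hy), Padic.valuation_pow, Padic.valuation_pow, hb] at this
  push_cast at this
  omega

lemma local_square {p : ℕ} [Fact p.Prime] (a b : ℤ) (hpb : (p : ℤ) ∣ b)
    (hpb2 : ¬ (p : ℤ) ^ 2 ∣ b) (h : TSol ℚ_[p] a b) : ∃ t : ℤ, (p : ℤ) ∣ t ^ 2 - a := by
  have hp1 : (1 : ℝ) < p := by exact_mod_cast (Fact.out : p.Prime).one_lt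
  have hb0 : b ≠ 0 := by rintro rfl; simp at hpb2
  have hbv : (b : ℚ_[p]).valuation = 1 := by
    rw [Padic.valuation_intCast]
    have h1 : 1 ≤ padicValInt p b := by
      have := (padicValInt_dvd_iff (p := p) 1 b).1 (by simpa using hpb)
      tauto
    have h2 : ¬ 2 ≤ padicValInt p b := by
      intro h2
      exact hpb2 ((padicValInt_dvd_iff (p := p) 2 b).2 (Or.inr h2))
    omega
  obtain ⟨x, y, z, h0, h⟩ := h
  by_cases hx : x = 0
  · subst hx
    have h' : z ^ 2 = b * y ^ 2 := by rw [h]; ring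
    by_cases hy : y = 0
    · subst hy
      simp at h'
      simp [h'] at h0
    · exact (padic_parity hbv hy (by rw [h'])).elim
  · set u := z / x with hu
    set v := y / x with hv
    have huv : u ^ 2 - a = b * v ^ 2 := by
      rw [hu, hv]; field_simp; rw [h]; ring
    have ha1 : ‖(a : ℚ_[p])‖ ≤ 1 := Padic.norm_int_le_one a
    have hlt : ‖(b : ℚ_[p]) * v ^ 2‖ < 1 ∨ 1 < ‖(b : ℚ_[p]) * v ^ 2‖ := by
      rcases lt_trichotomy ‖(b : ℚ_[p]) * v ^ 2‖ 1 with h | h | h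
      · exact Or.inl h
      · exfalso
        have hv0 : v ≠ 0 := by rintro h'; rw [h'] at h; simp at h
        exact padic_parity (z := 1) hbv hv0 (by rw [h]; simp)
      · exact Or.inr h
    rcases hlt with hlt | hlt
    · have hu1 : ‖u‖ ≤ 1 := by
        have : ‖u ^ 2‖ ≤ 1 := by
          have e : u ^ 2 = b * v ^ 2 + a := by rw [← huv]; ring
          rw [e]
          exact (Padic.nonarchimedean _ _).trans (max_le hlt.le ha1)
        rw [norm_pow] at this
        exact (pow_le_one_iff_of_nonneg (norm_nonneg _) two_ne_zero).1 this
      let U : ℤ_[p] := ⟨u, hu1⟩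
      have hU : ‖U ^ 2 - (a : ℤ_[p])‖ < 1 := by
        rw [PadicInt.norm_def]
        push_cast
        change ‖u ^ 2 - (a : ℚ_[p])‖ < 1
        rw [huv]; exact hlt
      have hmem : U ^ 2 - (a : ℤ_[p]) ∈ RingHom.ker (PadicInt.toZMod (p := p)) := by
        rw [PadicInt.ker_toZMod, IsLocalRing.mem_maximalIdeal]
        exact PadicInt.mem_nonunits.2 hU
      rw [RingHom.mem_ker, map_sub, map_pow, map_intCast] at hmem
      obtain ⟨t, ht⟩ := ZMod.intCast_surjective (PadicInt.toZMod U)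
      refine ⟨t, (ZMod.intCast_zmod_eq_zero_iff_dvd _ p).1 ?_⟩
      push_cast
      rw [ht, hmem]
    · exfalso
      have hv0 : v ≠ 0 := by rintro h'; rw [h'] at hlt; simp at hlt; linarith
      apply padic_parity (z := u) hbv hv0
      have e : u ^ 2 = b * v ^ 2 + a := by rw [← huv]; ring
      rw [e, Padic.add_eq_max_of_ne (ne_of_gt (lt_of_le_of_lt ha1 hlt)),
        max_eq_left (ha1.trans hlt.le)]

lemma exists_small_sqrt (a b : ℤ) (hb : b ≠ 0) (t : ℤ) (h : b ∣ t ^ 2 - a) :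
    ∃ s : ℤ, b ∣ s ^ 2 - a ∧ 2 * |s| ≤ |b| := by
  refine ⟨t.bmod b.natAbs, ?_, ?_⟩
  · have h1 : b ∣ t.bmod b.natAbs - t := by
      rw [← Int.natAbs_dvd]
      exact Int.dvd_bmod_sub_self
    have e : t.bmod b.natAbs ^ 2 - a =
      (t.bmod b.natAbs - t) * (t.bmod b.natAbs + t) + (t ^ 2 - a) := by ring
    rw [e]; exact dvd_add (h1.mul_right _) h
  · have hpos : 0 < b.natAbs := Int.natAbs_pos.2 hb
    have h1 := Int.le_bmod (x := t) hpos
    have h2 := Int.bmod_le (x := t) hpos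
    rw [Int.abs_eq_natAbs b]
    rcases abs_cases (t.bmod b.natAbs) with ⟨h3, _⟩ | ⟨h3, _⟩ <;> rw [h3] <;> omega

lemma int_case (n : ℕ) : ∀ a b : ℤ, a ≠ 0 → b ≠ 0 → a.natAbs + b.natAbs ≤ n →
    TSol ℝ a b → (∀ (p : ℕ) [Fact p.Prime], TSol ℚ_[p] a b) → TSol ℚ a b := by
  induction n with
  | zero => intro a b ha hb hn; omega
  | succ n ih =>
    have key : ∀ a b : ℤ, a ≠ 0 → b ≠ 0 → a.natAbs + b.natAbs ≤ n + 1 → a.natAbs ≤ b.natAbs →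
        TSol ℝ a b → (∀ (p : ℕ) [Fact p.Prime], TSol ℚ_[p] a b) → TSol ℚ a b := by
      intro a b ha hb hn hab hR hp
      by_cases hb1 : b.natAbs = 1
      · have ha1 : a.natAbs = 1 := by omega
        rcases Int.natAbs_eq_iff.1 ha1 with rfl | rfl
        · exact ⟨1, 0, 1, by simp, by simp⟩
        rcases Int.natAbs_eq_iff.1 hb1 with rfl | rfl
        · exact ⟨0, 1, 1, by simp, by simp⟩
        obtain ⟨x, y, z, h0, h⟩ := hR
        push_cast at h
        exfalso
        have hx : x = 0 := by nlinarith [sq_nonneg x, sq_nonneg y, sq_nonneg z]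
        have hy : y = 0 := by nlinarith [sq_nonneg x, sq_nonneg y, sq_nonneg z]
        have hz : z = 0 := by nlinarith [sq_nonneg x, sq_nonneg y, sq_nonneg z]
        simp [hx, hy, hz] at h0
      by_cases hsq : Squarefree b.natAbs
      · obtain ⟨t, ht⟩ := isSquare_of_primes a b.natAbs hsq (by
          intro p hpp hd
          haveI : Fact p.Prime := ⟨hpp⟩
          refine local_square a b (Int.natCast_dvd.2 hd) ?_ (hp p)
          intro h2
          have h3 : p * p ∣ b.natAbs := by
            rw [← Int.natCast_dvd]; push_cast; rwa [← sq]
          exact hpp.one_lt.ne' (Nat.isUnit_iff.1 (hsq p h3)))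
        rw [Int.natAbs_dvd] at ht
        obtain ⟨s, ⟨c, hc⟩, hs⟩ := exists_small_sqrt a b hb t ht
        by_cases hc0 : c = 0
        · refine ⟨1, 0, s, by simp, ?_⟩
          subst hc0
          have : s ^ 2 = a := by linarith
          rw [← this]; push_cast; ring
        have hcb : c.natAbs < b.natAbs := by
          zify
          have h1 : |b| * |c| ≤ |s| ^ 2 + |a| := by
            rw [← abs_mul, ← hc, ← abs_pow]; exact abs_sub _ _
          have h2 : |a| ≤ |b| := by zify at hab; exact hab
          have h3 : 2 ≤ |b| := by
            rw [Int.abs_eq_natAbs]; omega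
          have h4 : 0 ≤ |s| := abs_nonneg s
          by_contra! hcon
          nlinarith
        have tr : ∀ (K : Type) [Field K] [CharZero K], TSol K a b → TSol K a c := by
          intro K _ _ h
          refine h.trade (t := (s : K)) (by exact_mod_cast hb) ?_
          exact_mod_cast hc
        have := ih a c ha hc0 (by omega) (tr ℝ hR) (fun p _ => tr ℚ_[p] (hp p))
        refine this.trade (t := (s : ℚ)) (by exact_mod_cast hc0) ?_
        rw [mul_comm]; exact_mod_cast hc
      · rw [Nat.squarefree_iff_prime_squarefree] at hsq
        push Not at hsq
        obtain ⟨k, hk, hd⟩ := hsq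
        rw [← Int.natCast_dvd] at hd
        obtain ⟨c, hc⟩ := hd
        have hbc : b = c * (k : ℤ) ^ 2 := by rw [hc]; push_cast; ring
        have hc0 : c ≠ 0 := by rintro rfl; simp at hbc; exact hb hbc
        have hk2 := hk.two_le
        have hcb : c.natAbs < b.natAbs := by
          rw [hbc, Int.natAbs_mul, Int.natAbs_pow, Int.natAbs_natCast]
          have : 0 < c.natAbs := Int.natAbs_pos.2 hc0
          exact lt_mul_of_one_lt_right this (by nlinarith)
        have tr : ∀ (K : Type) [Field K] [CharZero K], TSol K a b → TSol K a c := by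
          intro K _ _ h
          refine TSol.of_mul_sq (k := (k : K)) (by exact_mod_cast hk.ne_zero) ?_
          rw [hbc] at h
          exact_mod_cast h
        have := ih a c ha hc0 (by omega) (tr ℝ hR) (fun p _ => tr ℚ_[p] (hp p))
        have := this.mul_sq (k := (k : ℚ)) (by exact_mod_cast hk.ne_zero)
        rw [hbc]
        exact_mod_cast this
    intro a b ha hb hn hR hp
    rcases le_total a.natAbs b.natAbs with hab | hab
    · exact key a b ha hb hn hab hR hp
    · exact (key b a hb ha (by omega) hab hR.symm (fun p _ => (hp p).symm)).symm

/-- Hasse–Minkowski for ternary quadratic forms over ℚ: if `a, b, c` are nonzero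
rationals and `a·x² + b·y² + c·z² = 0` has a nontrivial solution over `ℝ` and over every `ℚ_p`,
then it has a nontrivial rational solution. -/
theorem hasse_minkowski_ternary
    (a b c : ℚ) (ha : a ≠ 0) (hb : b ≠ 0) (hc : c ≠ 0)
    (hR : ∃ x y z : ℝ, (x, y, z) ≠ (0, 0, 0) ∧
      (a : ℝ) * x ^ 2 + (b : ℝ) * y ^ 2 + (c : ℝ) * z ^ 2 = 0)
    (hp : ∀ (p : ℕ) [Fact p.Prime], ∃ x y z : ℚ_[p], (x, y, z) ≠ (0, 0, 0) ∧
      (a : ℚ_[p]) * x ^ 2 + (b : ℚ_[p]) * y ^ 2 + (c : ℚ_[p]) * z ^ 2 = 0) :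
    ∃ x y z : ℚ, (x, y, z) ≠ (0, 0, 0) ∧ a * x ^ 2 + b * y ^ 2 + c * z ^ 2 = 0 := by
  -- integers in the square classes of `-a/c`, `-b/c`
  have cls : ∀ q : ℚ, q ≠ 0 → ∃ (m : ℤ) (d : ℚ), m ≠ 0 ∧ d ≠ 0 ∧ (m : ℚ) = q * d ^ 2 := by
    intro q hq
    refine ⟨q.num * q.den, q.den, mul_ne_zero (Rat.num_ne_zero.2 hq)
      (by exact_mod_cast q.den_nz), by exact_mod_cast q.den_nz, ?_⟩
    push_cast
    rw [sq, ← mul_assoc, Rat.mul_den_eq_num]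
  obtain ⟨m, d, hm, hd, hmd⟩ := cls (-a / c) (div_ne_zero (neg_ne_zero.2 ha) hc)
  obtain ⟨n, e, hn, he, hne⟩ := cls (-b / c) (div_ne_zero (neg_ne_zero.2 hb) hc)
  have tr : ∀ (K : Type) [Field K] [CharZero K], (∃ x y z : K, (x, y, z) ≠ (0, 0, 0) ∧
      (a : K) * x ^ 2 + (b : K) * y ^ 2 + (c : K) * z ^ 2 = 0) → TSol K m n := by
    rintro K _ _ ⟨x, y, z, h0, h⟩
    have hcK : (c : K) ≠ 0 := by exact_mod_cast hc
    have hdK : (d : K) ≠ 0 := by exact_mod_cast hd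
    have heK : (e : K) ≠ 0 := by exact_mod_cast he
    have hmK : (m : K) = (-a / c : K) * (d : K) ^ 2 := by exact_mod_cast congrArg (Rat.cast : ℚ → K) hmd
    have hnK : (n : K) = (-b / c : K) * (e : K) ^ 2 := by exact_mod_cast congrArg (Rat.cast : ℚ → K) hne
    rw [hmK, hnK]
    apply TSol.mul_sq heK
    apply TSol.symm
    apply TSol.mul_sq hdK
    apply TSol.symm
    refine ⟨x, y, z, ?_, ?_⟩
    · by_contra! hcon
      exact h0 (by simp [hcon])
    · field_simp
      linear_combination h
  have := int_case _ m n hm hn le_rfl (tr ℝ hR) (fun p _ => tr ℚ_[p] (hp p))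
  rw [hmd, hne] at this
  have h1 := (TSol.of_mul_sq hd (TSol.of_mul_sq he this).symm).symm
  obtain ⟨x, y, z, h0, h⟩ := h1
  refine ⟨x, y, z, ?_, ?_⟩
  · intro hcon
    simp only [Prod.mk.injEq] at hcon
    tauto
  · rw [h]; field_simp; ring
end
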